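/- Every shortest-path metric supported on a graph of pathwidth at most 2 admits a stochastic 108-embedding into the family of shortest-path metrics supported on trees. In particular, Pathwidth(2) ⇝ Trees. -/

import Mathlib

open scoped BigOperators

/-- A path decomposition of `G` with `t` bags. -/
def IsPathDecomp {V : Type*} (G : SimpleGraph V) (t : ℕ) (X : Fin t → Finset V) : Prop :=
  (∀ v : V, ∃ i, v ∈ X i) ∧
  (∀ ⦃u v : V⦄, G.Adj u v → ∃ i, u ∈ X i ∧ v ∈ X i) ∧
  (∀ (v : V) (i j l : Fin t), i ≤ j → j ≤ l → v ∈ X i → v ∈ X l → v ∈ X j)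

/-- The pathwidth of `G` is at most `k`. -/
def pathwidthLE {V : Type*} (G : SimpleGraph V) (k : ℕ) : Prop :=
  ∃ (t : ℕ) (X : Fin t → Finset V), IsPathDecomp G t X ∧ ∀ i, (X i).card ≤ k + 1

/-- The pathwidth of `G`. -/
noncomputable def pathwidth {V : Type*} (G : SimpleGraph V) : ℕ :=
  sInf {k | pathwidthLE G k}
/-- Shortest-path (pseudo)metric of the metric graph `(G, len)`. -/
noncomputable def spDist {V : Type*} (G : SimpleGraph V) (len : Sym2 V → ℝ) (u v : V) : ℝ :=
  sInf (Set.range fun w : G.Walk u v => (w.edges.map len).sum)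
/-- A finite "metric space": a size `n` together with a distance function on `Fin n`. -/
def FinMetric : Type := (n : ℕ) × (Fin n → Fin n → ℝ)

/-- A family of finite graphs (one set of graphs for each vertex count). -/
def GraphFamily : Type := ∀ n : ℕ, Set (SimpleGraph (Fin n))

/-- The shortest-path metrics supported on (connected) metric graphs from the family `F`. -/
def SupportedMetrics (F : GraphFamily) : Set FinMetric :=
  { Y | ∃ G ∈ F Y.1, G.Connected ∧ ∃ len : Sym2 (Fin Y.1) → ℝ,
      (∀ e, 0 ≤ len e) ∧ ∀ u v, Y.2 u v = spDist G len u v }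
/-- `(X, d)` admits a stochastic `D`-embedding into the family `𝒴`: there is a finitely
supported random metric space `Y ∈ 𝒴` and a random map `F` into it which is almost surely
non-contracting, and whose expected expansion is at most `D` on every pair. -/
def StochEmbeds {X : Type*} [Fintype X] (d : X → X → ℝ) (𝒴 : Set FinMetric) (D : ℝ) : Prop :=
  ∃ (N : ℕ) (p : Fin N → ℝ) (Y : Fin N → FinMetric) (F : (ω : Fin N) → X → Fin (Y ω).1),
    (∀ ω, 0 ≤ p ω) ∧ (∑ ω, p ω = 1) ∧
    (∀ ω, p ω ≠ 0 → Y ω ∈ 𝒴) ∧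
    (∀ ω, p ω ≠ 0 → ∀ x y, d x y ≤ (Y ω).2 (F ω x) (F ω y)) ∧
    (∀ x y, (∑ ω, p ω * (Y ω).2 (F ω x) (F ω y)) ≤ D * d x y)
/-- All graphs of pathwidth at most `k`. -/
def PathwidthFam (k : ℕ) : GraphFamily := fun _ => {G | pathwidthLE G k}

/-- All trees (connected acyclic graphs). -/
def TreeFam : GraphFamily := fun _ => {G | G.IsTree}

/-- All trees of pathwidth at most `k`. -/
def TreePathwidthFam (k : ℕ) : GraphFamily := fun _ => {G | G.IsTree ∧ pathwidthLE G k}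

lemma spDist_le_walk {V : Type*} {G : SimpleGraph V} {len : Sym2 V → ℝ} (hlen : ∀ e, 0 ≤ len e)
    {u v : V} (w : G.Walk u v) : spDist G len u v ≤ (w.edges.map len).sum := by
  refine csInf_le ⟨0, ?_⟩ ⟨w, rfl⟩
  rintro _ ⟨w, rfl⟩
  exact List.sum_nonneg (by simpa using fun e _ => hlen e)

lemma spDist_nonneg {V : Type*} {G : SimpleGraph V} {len : Sym2 V → ℝ} (hlen : ∀ e, 0 ≤ len e)
    (u v : V) : 0 ≤ spDist G len u v := by
  apply Real.sInf_nonneg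
  rintro _ ⟨w, rfl⟩
  exact List.sum_nonneg (by simpa using fun e _ => hlen e)

lemma le_spDist {V : Type*} {G : SimpleGraph V} {len : Sym2 V → ℝ} {u v : V}
    (h : G.Reachable u v) {r : ℝ} (hr : ∀ w : G.Walk u v, r ≤ (w.edges.map len).sum) :
    r ≤ spDist G len u v := by
  obtain ⟨w⟩ := h
  refine le_csInf ⟨_, w, rfl⟩ ?_
  rintro _ ⟨w, rfl⟩
  exact hr w

lemma spDist_self {V : Type*} {G : SimpleGraph V} {len : Sym2 V → ℝ} (hlen : ∀ e, 0 ≤ len e)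
    (u : V) : spDist G len u u = 0 :=
  le_antisymm (by simpa using spDist_le_walk hlen (SimpleGraph.Walk.nil : G.Walk u u))
    (spDist_nonneg hlen u u)

lemma spDist_comm {V : Type*} (G : SimpleGraph V) (len : Sym2 V → ℝ) (u v : V) :
    spDist G len u v = spDist G len v u := by
  unfold spDist
  congr 1
  ext r
  constructor <;>
  · rintro ⟨w, rfl⟩
    exact ⟨w.reverse, by simp [List.sum_reverse]⟩

lemma spDist_triangle {V : Type*} {G : SimpleGraph V} {len : Sym2 V → ℝ} (hlen : ∀ e, 0 ≤ len e)
    {u v w : V} (huv : G.Reachable u v) (hvw : G.Reachable v w) :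
    spDist G len u w ≤ spDist G len u v + spDist G len v w := by
  have h : ∀ p : G.Walk u v, spDist G len u w - (p.edges.map len).sum ≤ spDist G len v w := by
    intro p
    refine le_spDist hvw fun q => ?_
    have := spDist_le_walk hlen (p.append q)
    simp only [SimpleGraph.Walk.edges_append, List.map_append, List.sum_append] at this
    linarith
  have := le_spDist (len := len) huv (r := spDist G len u w - spDist G len v w)
    fun p => by linarith [h p]
  linarith

lemma spDist_le_of_adj {V : Type*} {G : SimpleGraph V} {len : Sym2 V → ℝ} (hlen : ∀ e, 0 ≤ len e)
    {u v : V} (h : G.Adj u v) : spDist G len u v ≤ len s(u, v) := by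
  simpa using spDist_le_walk hlen h.toWalk

lemma spDist_anti {V : Type*} {G H : SimpleGraph V} {len : Sym2 V → ℝ} (hlen : ∀ e, 0 ≤ len e)
    (hGH : G ≤ H) {u v : V} (h : G.Reachable u v) : spDist H len u v ≤ spDist G len u v := by
  refine le_spDist h fun w => ?_
  simpa using spDist_le_walk hlen (w.mapLe hGH)

/-- A function that satisfies the triangle inequality along the edges of a walk is at most
the total length of the walk. -/
lemma le_sum_edges {V : Type*} {G : SimpleGraph V} {len : Sym2 V → ℝ} {ρ : V → V → ℝ}
    (h0 : ∀ u, ρ u u ≤ 0) (h : ∀ u v w, G.Adj u v → ρ u w ≤ len s(u, v) + ρ v w) {u v : V}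
    (w : G.Walk u v) : ρ u v ≤ (w.edges.map len).sum := by
  induction w with
  | nil => simpa using h0 _
  | cons hadj p ih =>
    simp only [SimpleGraph.Walk.edges_cons, List.map_cons, List.sum_cons]
    exact (h _ _ _ hadj).trans (by gcongr)

/-- A finitely supported random forest on `V` whose only nontrivial component spans `S`. -/
structure RandomTree {V : Type} (S : Finset V) where
  ι : Type
  [fin : Fintype ι]
  p : ι → ℝ
  T : ι → SimpleGraph V
  nonneg : ∀ ω, 0 ≤ p ω
  sum_one : ∑ ω, p ω = 1
  acyclic : ∀ ω, (T ω).IsAcyclic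
  reachable : ∀ ω, ∀ u ∈ S, ∀ v ∈ S, (T ω).Reachable u v
  mem_of_adj : ∀ ω u v, (T ω).Adj u v → u ∈ S

namespace RandomTree

attribute [instance] RandomTree.fin

variable {V : Type} {S : Finset V}

/-- Expected tree distance. -/
noncomputable def E (D : RandomTree S) (len : Sym2 V → ℝ) (u v : V) : ℝ :=
  ∑ ω, D.p ω * spDist (D.T ω) len u v

lemma E_self (D : RandomTree S) {len : Sym2 V → ℝ} (hlen : ∀ e, 0 ≤ len e) (u : V) :
    D.E len u u = 0 := by
  simp [E, spDist_self hlen]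

lemma E_comm (D : RandomTree S) (len : Sym2 V → ℝ) (u v : V) : D.E len u v = D.E len v u := by
  simp only [E, spDist_comm _ _ u v]

lemma E_nonneg (D : RandomTree S) {len : Sym2 V → ℝ} (hlen : ∀ e, 0 ≤ len e) (u v : V) :
    0 ≤ D.E len u v :=
  Finset.sum_nonneg fun ω _ => mul_nonneg (D.nonneg ω) (spDist_nonneg hlen u v)

lemma E_triangle (D : RandomTree S) {len : Sym2 V → ℝ} (hlen : ∀ e, 0 ≤ len e) {u v w : V}
    (hu : u ∈ S) (hv : v ∈ S) (hw : w ∈ S) : D.E len u w ≤ D.E len u v + D.E len v w := by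
  simp only [E, ← Finset.sum_add_distrib, ← mul_add]
  exact Finset.sum_le_sum fun ω _ => mul_le_mul_of_nonneg_left
    (spDist_triangle hlen (D.reachable ω u hu v hv) (D.reachable ω v hv w hw)) (D.nonneg ω)

/-- The deterministic one-vertex tree. -/
def single (v : V) : RandomTree {v} where
  ι := Unit
  p _ := 1
  T _ := ⊥
  nonneg _ := zero_le_one
  sum_one := by simp
  acyclic _ := SimpleGraph.isAcyclic_bot
  reachable _ u hu w hw := by
    rw [Finset.mem_singleton] at hu hw
    rw [hu, hw]
  mem_of_adj _ u w h := by simp at h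

/-- Choose the second random tree with probability `q`, the first one otherwise. -/
noncomputable def mix (D₁ D₂ : RandomTree S) (q : ℝ) (h0 : 0 ≤ q) (h1 : q ≤ 1) : RandomTree S where
  ι := D₁.ι ⊕ D₂.ι
  p := Sum.elim (fun ω => (1 - q) * D₁.p ω) (fun ω => q * D₂.p ω)
  T := Sum.elim D₁.T D₂.T
  nonneg := by
    rintro (ω | ω)
    · exact mul_nonneg (sub_nonneg.2 h1) (D₁.nonneg ω)
    · exact mul_nonneg h0 (D₂.nonneg ω)
  sum_one := by
    simp [← Finset.mul_sum, D₁.sum_one, D₂.sum_one]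
  acyclic := by
    rintro (ω | ω)
    · exact D₁.acyclic ω
    · exact D₂.acyclic ω
  reachable := by
    rintro (ω | ω)
    · exact D₁.reachable ω
    · exact D₂.reachable ω
  mem_of_adj := by
    rintro (ω | ω)
    · exact D₁.mem_of_adj ω
    · exact D₂.mem_of_adj ω

lemma E_mix (D₁ D₂ : RandomTree S) (len : Sym2 V → ℝ) (q : ℝ) (h0 : 0 ≤ q) (h1 : q ≤ 1)
    (u v : V) :
    (mix D₁ D₂ q h0 h1).E len u v = (1 - q) * D₁.E len u v + q * D₂.E len u v := by
  refine (Fintype.sum_sum_type _).trans ?_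
  simp [E, mix, Finset.mul_sum, mul_assoc]

variable {a c : V}

lemma not_reachable (D : RandomTree S) (ω : D.ι) (ha : a ∈ S) (hc : c ∉ S) :
    ¬ (D.T ω).Reachable a c := by
  rintro ⟨w⟩
  cases w.reverse with
  | nil => exact hc ha
  | cons h _ => exact hc (D.mem_of_adj ω _ _ h)

variable [DecidableEq V]

/-- Attach a new vertex `c` as a leaf to `a`. -/
def attach (D : RandomTree S) (ha : a ∈ S) (hc : c ∉ S) : RandomTree (insert c S) where
  ι := D.ι
  p := D.p
  T ω := D.T ω ⊔ SimpleGraph.edge a c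
  nonneg := D.nonneg
  sum_one := D.sum_one
  acyclic ω := (D.acyclic ω).sup_edge_of_not_reachable (D.not_reachable ω ha hc)
  reachable ω := by
    have hac : (D.T ω ⊔ SimpleGraph.edge a c).Adj a c :=
      Or.inr (SimpleGraph.edge_adj _ _ _ _ |>.2 ⟨Or.inl ⟨rfl, rfl⟩, fun h => hc (h ▸ ha)⟩)
    have key : ∀ u ∈ insert c S, (D.T ω ⊔ SimpleGraph.edge a c).Reachable a u := by
      intro u hu
      rcases Finset.mem_insert.1 hu with rfl | hu
      · exact hac.reachable
      · exact (D.reachable ω a ha u hu).mono le_sup_left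
    exact fun u hu v hv => (key u hu).symm.trans (key v hv)
  mem_of_adj ω u v h := by
    rcases h with h | h
    · exact Finset.mem_insert_of_mem (D.mem_of_adj ω u v h)
    · rcases ((SimpleGraph.edge_adj _ _ _ _).1 h).1 with ⟨rfl, rfl⟩ | ⟨rfl, rfl⟩
      · exact Finset.mem_insert_of_mem ha
      · exact Finset.mem_insert_self _ _

variable {len : Sym2 V → ℝ}

lemma E_attach_le (D : RandomTree S) (hlen : ∀ e, 0 ≤ len e) (ha : a ∈ S) (hc : c ∉ S) {u v : V}
    (hu : u ∈ S) (hv : v ∈ S) : (D.attach ha hc).E len u v ≤ D.E len u v :=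
  Finset.sum_le_sum fun ω _ => mul_le_mul_of_nonneg_left
    (spDist_anti hlen le_sup_left (D.reachable ω u hu v hv)) (D.nonneg ω)

lemma E_attach_leaf_le (D : RandomTree S) (hlen : ∀ e, 0 ≤ len e) (ha : a ∈ S) (hc : c ∉ S) :
    (D.attach ha hc).E len a c ≤ len s(a, c) := by
  calc (D.attach ha hc).E len a c ≤ ∑ ω, D.p ω * len s(a, c) := by
        refine Finset.sum_le_sum fun ω _ => mul_le_mul_of_nonneg_left
          (spDist_le_of_adj hlen ?_) (D.nonneg ω)
        exact Or.inr (SimpleGraph.edge_adj _ _ _ _ |>.2 ⟨Or.inl ⟨rfl, rfl⟩, fun h => hc (h ▸ ha)⟩)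
    _ = len s(a, c) := by rw [← Finset.sum_mul, D.sum_one, one_mul]

lemma E_attach_new_le (D : RandomTree S) (hlen : ∀ e, 0 ≤ len e) (ha : a ∈ S) (hc : c ∉ S) {b : V}
    (hb : b ∈ S) : (D.attach ha hc).E len b c ≤ D.E len a b + len s(a, c) := by
  have h1 := (D.attach ha hc).E_triangle hlen (Finset.mem_insert_of_mem hb)
    (Finset.mem_insert_of_mem ha) (Finset.mem_insert_self c S)
  have h2 := D.E_attach_le hlen ha hc hb ha
  rw [D.E_comm len b a] at h2
  linarith [D.E_attach_leaf_le hlen ha hc]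

/-- Attach `c` to `b` with probability `q` and to `a` otherwise. -/
lemma exists_attach (D : RandomTree S) (hlen : ∀ e, 0 ≤ len e) {b : V} (ha : a ∈ S) (hb : b ∈ S)
    (hc : c ∉ S) {q : ℝ} (h0 : 0 ≤ q) (h1 : q ≤ 1) :
    ∃ D' : RandomTree (insert c S), (∀ u ∈ S, ∀ v ∈ S, D'.E len u v ≤ D.E len u v) ∧
      D'.E len a c ≤ (1 - q) * len s(a, c) + q * (D.E len a b + len s(b, c)) ∧
      D'.E len b c ≤ (1 - q) * (D.E len a b + len s(a, c)) + q * len s(b, c) := by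
  have h1' := sub_nonneg.2 h1
  refine ⟨mix (D.attach ha hc) (D.attach hb hc) q h0 h1, fun u hu v hv => ?_, ?_, ?_⟩ <;>
    rw [E_mix]
  · have e1 := mul_le_mul_of_nonneg_left (D.E_attach_le hlen ha hc hu hv) h1'
    have e2 := mul_le_mul_of_nonneg_left (D.E_attach_le hlen hb hc hu hv) h0
    linarith
  · have e := D.E_attach_new_le hlen hb hc ha
    rw [D.E_comm] at e
    exact add_le_add (mul_le_mul_of_nonneg_left (D.E_attach_leaf_le hlen ha hc) h1')
      (mul_le_mul_of_nonneg_left e h0)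
  · exact add_le_add (mul_le_mul_of_nonneg_left (D.E_attach_new_le hlen ha hc hb) h1')
      (mul_le_mul_of_nonneg_left (D.E_attach_leaf_le hlen hb hc) h0)

end RandomTree

lemma exists_balanced_prob {x y M : ℝ} (hx : 0 ≤ x) (hy : 0 ≤ y) (hM : M ≤ 3 * (x + y)) :
    ∃ q, 0 ≤ q ∧ q ≤ 1 ∧ (1 - q) * x + q * (M + y) ≤ 12 * x ∧
      (1 - q) * (M + x) + q * y ≤ 12 * y := by
  rcases (add_nonneg hx hy).eq_or_lt with h | h
  · exact ⟨0, le_rfl, zero_le_one, by linarith, by linarith⟩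
  · refine ⟨x / (x + y), by positivity, (div_le_one h).2 (by linarith), ?_, ?_⟩
    · have : (1 - x / (x + y)) * x + x / (x + y) * (M + y) = x * (M + 2 * y) / (x + y) := by
        field_simp; ring
      rw [this, div_le_iff₀ h]
      nlinarith [mul_le_mul_of_nonneg_left hM hx]
    · have : (1 - x / (x + y)) * (M + x) + x / (x + y) * y = y * (M + 2 * x) / (x + y) := by
        field_simp; ring
      rw [this, div_le_iff₀ h]
      nlinarith [mul_le_mul_of_nonneg_left hM hy]

lemma exists_switching_prob {x y M : ℝ} (hx : 0 ≤ x) (hy : 0 ≤ y) (hM : M ≤ 3 * (x + y)) :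
    ∃ q, 0 ≤ q ∧ q ≤ 1 ∧ (1 - q) * x + q * (M + y) ≤ 12 * x ∧
      (1 - q) * (M + x) + q * y ≤ 3 * y := by
  rcases le_or_gt y (2 * x) with h | h
  · exact ⟨1, zero_le_one, le_rfl, by linarith, by linarith⟩
  · have hy' : 0 < y := by linarith
    obtain ⟨q, hq⟩ : ∃ q, q = 2 * x / y := ⟨_, rfl⟩
    have hqy : q * y = 2 * x := by rw [hq]; field_simp
    have hq0 : 0 ≤ q := by rw [hq]; positivity
    have hq1 : q ≤ 1 := by rw [hq, div_le_one hy']; exact h.le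
    have e1 := mul_le_mul_of_nonneg_left hM hq0
    have e2 := mul_le_mul_of_nonneg_left hM (sub_nonneg.2 hq1)
    have e3 := mul_le_mul_of_nonneg_right hq1 hx
    have e4 := mul_nonneg hq0 hx
    exact ⟨q, hq0, hq1, by nlinarith, by nlinarith⟩

lemma subset_pair_of_card_le_two {V : Type*} [DecidableEq V] {A : Finset V} {a b c : V}
    (hA : A ⊆ insert c {a, b}) (h : A.card ≤ 2) : A ⊆ {a, b} ∨ A ⊆ {b, c} ∨ A ⊆ {a, c} := by
  by_contra! hcon
  obtain ⟨h1, h2, h3⟩ := hcon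
  simp only [Finset.subset_iff, Finset.mem_insert, Finset.mem_singleton, not_forall] at hA h1 h2 h3
  obtain ⟨u, hu, hu'⟩ := h1
  obtain ⟨v, hv, hv'⟩ := h2
  obtain ⟨w, hw, hw'⟩ := h3
  have : ({u, v, w} : Finset V).card = 3 := by
    rw [Finset.card_eq_three]
    exact ⟨u, v, w, by grind, by grind, by grind, rfl⟩
  have hle : ({u, v, w} : Finset V).card ≤ A.card := Finset.card_le_card (by grind)
  omega

/-- The vertices `v 0, …, v (n - 1)` are inserted one by one; `A k` holds the earlier neighbours
of `v k`. -/
lemma exists_randomTree {V : Type} [DecidableEq V] {len : Sym2 V → ℝ} (hlen : ∀ e, 0 ≤ len e)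
    (htri : ∀ u v w, len s(u, w) ≤ len s(u, v) + len s(v, w)) {n : ℕ} (v : ℕ → V)
    (hv : ∀ k < n, v k ∉ (Finset.range k).image v) (A : ℕ → Finset V) (hA0 : A 0 = ∅)
    (hA : ∀ k, (A k).card ≤ 2) (hAs : ∀ k, A (k + 1) ⊆ insert (v k) (A k)) :
    ∀ k < n, ∃ D : RandomTree ((Finset.range (k + 1)).image v),
      (∀ j ≤ k, ∀ u ∈ A j, D.E len u (v j) ≤ 12 * len s(u, v j)) ∧
      ∃ a ∈ (Finset.range (k + 1)).image v, ∃ b ∈ (Finset.range (k + 1)).image v,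
        A (k + 1) ⊆ {a, b} ∧ D.E len a b ≤ 3 * len s(a, b) := by
  intro k
  induction k with
  | zero =>
    intro _
    have h : (Finset.range (0 + 1)).image v = {v 0} := by simp
    rw [h]
    refine ⟨RandomTree.single (v 0), ?_, v 0, by simp, v 0, by simp, ?_, ?_⟩
    · intro j hj u hu
      obtain rfl : j = 0 := by omega
      simp [hA0] at hu
    · simpa [hA0] using hAs 0
    · rw [RandomTree.E_self _ hlen]
      linarith [hlen s(v 0, v 0)]
  | succ k ih =>
    intro hk
    obtain ⟨D, hD, a, ha, b, hb, hab, hE⟩ := ih (by omega)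
    have hc := hv (k + 1) hk
    have hS : (Finset.range (k + 1 + 1)).image v =
        insert (v (k + 1)) ((Finset.range (k + 1)).image v) := by
      rw [Finset.range_add_one, Finset.image_insert]
    rw [hS]
    have hmem : ∀ j ≤ k, v j ∈ (Finset.range (k + 1)).image v := fun j hj =>
      Finset.mem_image_of_mem v (Finset.mem_range.2 (by omega))
    have hAmem : ∀ j, A j ⊆ (Finset.range j).image v := by
      intro j
      induction j with
      | zero => simp [hA0]
      | succ j ih =>
        rw [Finset.range_add_one, Finset.image_insert]
        exact (hAs j).trans (Finset.insert_subset_insert _ ih)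
    -- A new tree with the right distances on the old pairs and from `v (k + 1)` will do.
    have finish : ∀ D' : RandomTree (insert (v (k + 1)) ((Finset.range (k + 1)).image v)),
        (∀ u ∈ (Finset.range (k + 1)).image v, ∀ w ∈ (Finset.range (k + 1)).image v,
          D'.E len u w ≤ D.E len u w) →
        D'.E len a (v (k + 1)) ≤ 12 * len s(a, v (k + 1)) →
        D'.E len b (v (k + 1)) ≤ 12 * len s(b, v (k + 1)) →
        ∀ j ≤ k + 1, ∀ u ∈ A j, D'.E len u (v j) ≤ 12 * len s(u, v j) := by
      intro D' h1 h2 h3 j hj u hu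
      rcases hj.eq_or_lt with rfl | hj
      · rcases Finset.mem_insert.1 (hab hu) with rfl | h
        · exact h2
        · rw [Finset.mem_singleton.1 h]
          exact h3
      · have hj : j ≤ k := by omega
        refine (h1 u ?_ _ (hmem j hj)).trans (hD j hj u hu)
        exact Finset.image_subset_image (Finset.range_subset_range.2 (by omega)) (hAmem j hu)
    have hx := hlen s(a, v (k + 1))
    have hy := hlen s(b, v (k + 1))
    have hxy := htri a (v (k + 1)) b
    rw [Sym2.eq_swap (a := v (k + 1))] at hxy
    have hcS := Finset.mem_insert_self (v (k + 1)) ((Finset.range (k + 1)).image v)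
    have haS := Finset.mem_insert_of_mem (b := v (k + 1)) ha
    have hbS := Finset.mem_insert_of_mem (b := v (k + 1)) hb
    rcases subset_pair_of_card_le_two ((hAs (k + 1)).trans (Finset.insert_subset_insert _ hab))
      (hA _) with h | h | h
    · obtain ⟨q, h0, h1, e1, e2⟩ := exists_balanced_prob hx hy (M := D.E len a b) (by linarith)
      obtain ⟨D', f1, f2, f3⟩ := D.exists_attach hlen ha hb hc h0 h1
      exact ⟨D', finish D' f1 (f2.trans e1) (f3.trans e2), a, haS, b, hbS, h,
        (f1 a ha b hb).trans hE⟩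
    · obtain ⟨q, h0, h1, e1, e2⟩ := exists_switching_prob hx hy (M := D.E len a b) (by linarith)
      obtain ⟨D', f1, f2, f3⟩ := D.exists_attach hlen ha hb hc h0 h1
      have f3 := f3.trans e2
      exact ⟨D', finish D' f1 (f2.trans e1) (by linarith), b, hbS, _, hcS, h, f3⟩
    · obtain ⟨q, h0, h1, e1, e2⟩ := exists_switching_prob hy hx (M := D.E len b a)
        (by rw [D.E_comm]; linarith)
      obtain ⟨D', f1, f2, f3⟩ := D.exists_attach hlen hb ha hc h0 h1
      have f3 := f3.trans e2
      exact ⟨D', finish D' f1 (by linarith) (f2.trans e1), a, haS, _, hcS, h, f3⟩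

/-- Every vertex ordering by first bag exhibits the structure used in `exists_randomTree`. -/
lemma exists_insertion_order {n : ℕ} [NeZero n] {G : SimpleGraph (Fin n)}
    (hG : pathwidthLE G 2) :
    ∃ (v : ℕ → Fin n) (A : ℕ → Finset (Fin n)), (∀ k < n, v k ∉ (Finset.range k).image v) ∧
      A 0 = ∅ ∧ (∀ k, (A k).card ≤ 2) ∧ (∀ k, A (k + 1) ⊆ insert (v k) (A k)) ∧
      ∀ u w, G.Adj u w → ∃ k < n, (u ∈ A k ∧ w = v k) ∨ (w ∈ A k ∧ u = v k) := by
  obtain ⟨t, X, ⟨hcov, hedge, hconv⟩, hcard⟩ := hG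
  have hfirst : ∀ u, ∃ i, u ∈ X i ∧ ∀ j, u ∈ X j → i ≤ j := fun u => by
    obtain ⟨i, hi, hmin⟩ := WellFounded.has_min (wellFounded_lt (α := Fin t))
      {i | u ∈ X i} (hcov u)
    exact ⟨i, hi, fun j hj => not_lt.1 (hmin j hj)⟩
  choose f hf hfmin using hfirst
  have hn : 0 < n := NeZero.pos n
  have hmono : Monotone (f ∘ Tuple.sort f) := Tuple.monotone_sort f
  generalize Tuple.sort f = σ at hmono
  let v : ℕ → Fin n := fun k => σ ⟨k % n, Nat.mod_lt k hn⟩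
  have hvlt : ∀ k (h : k < n), v k = σ ⟨k, h⟩ := fun k h => by
    simp only [v, Nat.mod_eq_of_lt h]
  have hinj : ∀ j k, j < n → k < n → v j = v k → j = k := fun j k hj hk h => by
    rw [hvlt j hj, hvlt k hk, σ.injective.eq_iff] at h
    simpa using h
  have hle : ∀ j k, j ≤ k → k < n → f (v j) ≤ f (v k) := fun j k hjk hk => by
    rw [hvlt j (by omega), hvlt k hk]
    exact hmono (by simpa using hjk)
  have hv : ∀ k < n, v k ∉ (Finset.range k).image v := by
    intro k hk h
    obtain ⟨j, hj, h⟩ := Finset.mem_image.1 h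
    rw [Finset.mem_range] at hj
    exact hj.ne (hinj j k (by omega) hk h)
  let A : ℕ → Finset (Fin n) := fun k =>
    if k < n then (Finset.range k).image v ∩ X (f (v k)) else ∅
  have hsurj : ∀ u, ∃ k < n, v k = u := fun u =>
    ⟨(σ.symm u).val, (σ.symm u).isLt, by rw [hvlt _ (σ.symm u).isLt]; simp⟩
  have hadj : ∀ j k i, j < k → k < n → v j ∈ X i → v k ∈ X i → v j ∈ A k := by
    intro j k i hjk hk hj hk'
    simp only [A, hk, if_true, Finset.mem_inter]
    exact ⟨Finset.mem_image_of_mem v (Finset.mem_range.2 hjk),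
      hconv _ _ _ _ (hle j k hjk.le hk) (hfmin _ _ hk') (hf _) hj⟩
  refine ⟨v, A, hv, ?_, ?_, ?_, ?_⟩
  · simp [A]
  · intro k
    by_cases hk : k < n
    · have h1 : v k ∉ A k := by
        simp only [A, hk, if_true, Finset.mem_inter]
        exact fun h => hv k hk h.1
      have h2 : insert (v k) (A k) ⊆ X (f (v k)) := by
        simp only [A, hk, if_true]
        exact Finset.insert_subset (hf _) Finset.inter_subset_right
      have h3 := Finset.card_le_card h2
      rw [Finset.card_insert_of_notMem h1] at h3
      have := hcard (f (v k))
      omega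
    · simp [A, hk]
  · intro k u hu
    by_cases hk : k + 1 < n
    · simp only [A, hk, if_true, Finset.mem_inter] at hu
      obtain ⟨j, hj, rfl⟩ := Finset.mem_image.1 hu.1
      rw [Finset.mem_range] at hj
      rcases (Nat.lt_succ_iff.1 hj).eq_or_lt with rfl | hj
      · exact Finset.mem_insert_self _ _
      · have hk' : k < n := by omega
        refine Finset.mem_insert_of_mem (hadj j k (f (v k)) hj hk' ?_ (hf _))
        exact hconv _ _ _ _ (hle j k hj.le hk') (hle k (k + 1) k.le_succ hk) (hf _) hu.2
    · simp [A, hk] at hu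
  · intro u w huw
    obtain ⟨i, hu, hw⟩ := hedge huw
    obtain ⟨j, hj, rfl⟩ := hsurj u
    obtain ⟨k, hk, rfl⟩ := hsurj w
    rcases lt_trichotomy j k with h | rfl | h
    · exact ⟨k, hk, Or.inl ⟨hadj j k i h hk hu hw, rfl⟩⟩
    · exact absurd rfl huw.ne
    · exact ⟨j, hj, Or.inr ⟨hadj k j i h hj hw hu, rfl⟩⟩

/-- **Warm-up theorem.** Every shortest-path metric supported on a graph of pathwidth at most 2
admits a stochastic 108-embedding into the shortest-path metrics supported on trees; in
particular `Pathwidth(2) ⇝ Trees`. -/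
theorem pathwidth_two_into_trees :
    ∀ Y ∈ SupportedMetrics (PathwidthFam 2),
      StochEmbeds Y.2 (SupportedMetrics TreeFam) 108 := by
  rintro ⟨n, d⟩ ⟨G, hG, hconn, len, hlen, hd⟩
  change SimpleGraph (Fin n) at G
  change Sym2 (Fin n) → ℝ at len
  obtain rfl : d = spDist G len := funext fun u => funext fun v => hd u v
  have : NeZero n := ⟨by
    rintro rfl
    exact hconn.nonempty.elim Fin.elim0⟩
  obtain ⟨v, A, hv, hA0, hA, hAs, hadj⟩ := exists_insertion_order (n := n) hG
  let len' : Sym2 (Fin n) → ℝ := Sym2.lift ⟨spDist G len, spDist_comm G len⟩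
  have hlen' : ∀ e, 0 ≤ len' e := fun e => e.ind fun a b => spDist_nonneg hlen a b
  have htri : ∀ u w x, len' s(u, x) ≤ len' s(u, w) + len' s(w, x) := fun u w x =>
    spDist_triangle hlen (hconn u w) (hconn w x)
  have hn : 0 < n := NeZero.pos n
  obtain ⟨D, hD, -⟩ := exists_randomTree hlen' htri v hv A hA0 hA hAs (n - 1) (by omega)
  have hS : ∀ u, u ∈ (Finset.range (n - 1 + 1)).image v := by
    have hcard : ((Finset.range (n - 1 + 1)).image v).card = Fintype.card (Fin n) := by
      rw [Finset.card_image_of_injOn, Finset.card_range, Fintype.card_fin, Nat.sub_add_cancel hn]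
      intro j hj k hk h
      simp only [Finset.coe_range, Set.mem_Iio] at hj hk
      rcases lt_trichotomy j k with hlt | rfl | hlt
      · exact absurd (Finset.mem_image.2 ⟨j, Finset.mem_range.2 hlt, h⟩) (hv k (by omega))
      · rfl
      · exact absurd (Finset.mem_image.2 ⟨k, Finset.mem_range.2 hlt, h.symm⟩) (hv j (by omega))
    intro u
    rw [Finset.card_eq_iff_eq_univ] at hcard
    rw [hcard]
    exact Finset.mem_univ u
  have hEadj : ∀ u w, G.Adj u w → D.E len' u w ≤ 12 * len s(u, w) := by
    intro u w huw
    have hle : len' s(u, w) ≤ len s(u, w) := spDist_le_of_adj hlen huw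
    obtain ⟨k, hk, ⟨h, rfl⟩ | ⟨h, rfl⟩⟩ := hadj u w huw
    · linarith [hD k (by omega) u h]
    · have := hD k (by omega) w h
      rw [D.E_comm, Sym2.eq_swap] at this
      linarith
  have hE : ∀ u w, D.E len' u w ≤ 12 * spDist G len u w := by
    intro u w
    have : D.E len' u w / 12 ≤ spDist G len u w := by
      refine le_spDist (hconn u w) fun p =>
        le_sum_edges (ρ := fun u w => D.E len' u w / 12) (fun u => ?_) (fun u w x huw => ?_) p
      · simp [D.E_self hlen']
      · linarith [hEadj u w huw, D.E_triangle hlen' (hS u) (hS w) (hS x)]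
    linarith
  have htree : ∀ ω, (D.T ω).IsTree := fun ω =>
    ⟨⟨fun u w => D.reachable ω u (hS u) w (hS w)⟩, D.acyclic ω⟩
  let e := Fintype.equivFin D.ι
  refine ⟨Fintype.card D.ι, fun i => D.p (e.symm i), fun i => ⟨n, spDist (D.T (e.symm i)) len'⟩,
    fun _ => id, fun i => D.nonneg _, ?_, fun i _ => ?_, fun i _ x y => ?_, fun x y => ?_⟩
  · rw [e.symm.sum_comp, D.sum_one]
  · exact ⟨D.T (e.symm i), htree _, (htree _).connected, len', hlen', fun _ _ => rfl⟩
  · exact le_spDist ((htree _).connected x y) fun p =>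
      le_sum_edges (fun u => (spDist_self hlen u).le) (fun u w x _ => htri u w x) p
  · have := e.symm.sum_comp fun ω => D.p ω * spDist (D.T ω) len' x y
    refine this.trans_le ((hE x y).trans ?_)
    have := spDist_nonneg hlen (G := G) x y
    change 12 * spDist G len x y ≤ 108 * spDist G len x y
    linarith
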